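/- arXiv:1401.3282 — 11 statements merged into one kernel-verified Lean document; each statement's English description precedes it below -/
import Mathlib

section
/- Let G be a group with a gliding system, let S ⊆ 𝒢 be a set of glides, let T ⊆ S, and set S_T = (S \ T) ∪ {t⁻¹ | t ∈ T}. If S is pre-cubic then S_T is pre-cubic, and if S is cubic then S_T is cubic. -/
/-- A gliding system in a group `G`: a set of glides `𝒢 ⊆ G \ {1}` closed under
inversion, together with a symmetric independence relation `ℐ ⊆ 𝒢 × 𝒢` such that
independent glides commute and have product `≠ 1`, and independence is stable
under inverting a glide. -/
structure GlidingSystem (G : Type*) [Group G] where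
  glides : Set G
  indep : G → G → Prop
  glides_ne_one : ∀ s ∈ glides, s ≠ 1
  inv_mem : ∀ s ∈ glides, s⁻¹ ∈ glides
  indep_mem_left : ∀ {s t : G}, indep s t → s ∈ glides
  indep_mem_right : ∀ {s t : G}, indep s t → t ∈ glides
  indep_symm : ∀ {s t : G}, indep s t → indep t s
  indep_inv : ∀ {s t : G}, indep s t → indep s⁻¹ t
  indep_mul_comm : ∀ {s t : G}, indep s t → s * t = t * s
  indep_mul_ne_one : ∀ {s t : G}, indep s t → s * t ≠ 1

/-- The product `[S]` of a finite set of pairwise commuting elements of a group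
(defined as `1` if the elements do not pairwise commute). -/
noncomputable def finsetProd {G : Type*} [Group G] (S : Finset G) : G :=
  @dite _ ((S : Set G).Pairwise Commute) (Classical.propDecidable _)
    (fun h => S.noncommProd id h) (fun _ => 1)

/-- A set of glides is pre-cubic if it is finite and its distinct elements are
pairwise independent. -/
def IsPreCubic {G : Type*} [Group G] (GS : GlidingSystem G) (S : Finset G) : Prop :=
  (S : Set G) ⊆ GS.glides ∧ ∀ s ∈ S, ∀ t ∈ S, s ≠ t → GS.indep s t

/-- A pre-cubic set of glides is cubic if distinct subsets have distinct products. -/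
def IsCubic {G : Type*} [Group G] (GS : GlidingSystem G) (S : Finset G) : Prop :=
  IsPreCubic GS S ∧
    ∀ T₁ ⊆ S, ∀ T₂ ⊆ S, T₁ ≠ T₂ → finsetProd T₁ ≠ finsetProd T₂

theorem finsetProd_eq {G : Type*} [Group G] {S : Finset G}
    (h : (S : Set G).Pairwise Commute) : finsetProd S = S.noncommProd id h :=
  dif_pos h

theorem finsetProd_union {G : Type*} [Group G] [DecidableEq G] {A B : Finset G}
    (h : ((A ∪ B : Finset G) : Set G).Pairwise Commute) (hd : Disjoint A B) :
    finsetProd (A ∪ B) = finsetProd A * finsetProd B := by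
  rw [finsetProd_eq h, Finset.noncommProd_union_of_disjoint hd,
    finsetProd_eq (h.mono (by simp)), finsetProd_eq (h.mono (by simp))]

theorem Set.Pairwise.commute_image_inv {G : Type*} [Group G] [DecidableEq G] {S : Finset G}
    (h : (S : Set G).Pairwise Commute) :
    ((S.image (·⁻¹) : Finset G) : Set G).Pairwise Commute := by
  intro a ha b hb hab
  simp only [Finset.coe_image, Set.mem_image] at ha hb
  obtain ⟨x, hx, rfl⟩ := ha
  obtain ⟨y, hy, rfl⟩ := hb
  exact (h hx hy fun e => hab (by rw [e])).inv_inv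

theorem finsetProd_image_inv {G : Type*} [Group G] [DecidableEq G] {S : Finset G}
    (h : (S : Set G).Pairwise Commute) :
    finsetProd (S.image (·⁻¹)) = (finsetProd S)⁻¹ := by
  induction S using Finset.induction_on with
  | empty =>
    rw [Finset.image_empty, finsetProd_eq h, Finset.noncommProd_empty, inv_one]
  | insert a S ha ih =>
    have hS : (S : Set G).Pairwise Commute := h.mono (by simp)
    have hi := h.commute_image_inv
    rw [Finset.image_insert] at hi ⊢
    have ha' : a⁻¹ ∉ S.image (·⁻¹) := by simpa using ha
    rw [finsetProd_eq hi, finsetProd_eq h, Finset.noncommProd_insert_of_notMem _ _ _ _ ha',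
      Finset.noncommProd_insert_of_notMem' _ _ _ _ ha, ← finsetProd_eq hS,
      ← finsetProd_eq hS.commute_image_inv, ih hS]
    simp

theorem IsPreCubic.pairwise_commute {G : Type*} [Group G] {GS : GlidingSystem G} {S : Finset G}
    (h : IsPreCubic GS S) : (S : Set G).Pairwise Commute :=
  fun s hs t ht hst => GS.indep_mul_comm (h.2 s hs t ht hst)

theorem IsPreCubic.eq_of_inv_mem {G : Type*} [Group G] {GS : GlidingSystem G} {S : Finset G}
    (h : IsPreCubic GS S) {s : G} (hs : s ∈ S) (hs' : s⁻¹ ∈ S) : s⁻¹ = s := by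
  by_contra hne
  exact GS.indep_mul_ne_one (h.2 _ hs' _ hs hne) (inv_mul_cancel s)

theorem IsPreCubic.sdiff_union_image_inv {G : Type*} [Group G] [DecidableEq G]
    {GS : GlidingSystem G} {S T : Finset G} (h : IsPreCubic GS S) (hTS : T ⊆ S) :
    IsPreCubic GS ((S \ T) ∪ T.image (·⁻¹)) := by
  constructor
  · intro x hx
    simp only [Finset.coe_union, Finset.coe_sdiff, Finset.coe_image, Set.mem_union,
      Set.mem_image] at hx
    obtain hx | ⟨t, ht, rfl⟩ := hx
    · exact h.1 hx.1
    · exact GS.inv_mem t (h.1 (hTS ht))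
  · intro x hx y hy hxy
    simp only [Finset.mem_union, Finset.mem_sdiff, Finset.mem_image] at hx hy
    obtain hx | ⟨s, hs, rfl⟩ := hx <;> obtain hy | ⟨t, ht, rfl⟩ := hy
    · exact h.2 x hx.1 y hy.1 hxy
    · exact GS.indep_symm (GS.indep_inv (h.2 t (hTS ht) x hx.1 fun e => hx.2 (e ▸ ht)))
    · exact GS.indep_inv (h.2 s (hTS hs) y hy.1 fun e => hy.2 (e ▸ hs))
    · exact GS.indep_inv (GS.indep_symm (GS.indep_inv
        (h.2 t (hTS ht) s (hTS hs) fun e => hxy (by rw [e]))))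

theorem IsPreCubic.finsetProd_mul_finsetProd {G : Type*} [Group G] [DecidableEq G]
    {GS : GlidingSystem G} {S T U : Finset G} (h : IsPreCubic GS S) (hTS : T ⊆ S)
    (hU : U ⊆ (S \ T) ∪ T.image (·⁻¹)) :
    finsetProd U * finsetProd T =
      finsetProd (U ∩ (S \ T) ∪ T.filter (·⁻¹ ∉ U)) := by
  have hc := h.pairwise_commute
  have hUeq : U = U ∩ (S \ T) ∪ (T.filter (·⁻¹ ∈ U)).image (·⁻¹) := by
    ext x
    have := @hU x
    simp only [Finset.mem_union, Finset.mem_sdiff, Finset.mem_image, Finset.mem_inter,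
      Finset.mem_filter] at this ⊢
    constructor
    · intro hx
      obtain hx' | ⟨t, ht, rfl⟩ := this hx
      · exact .inl ⟨hx, hx'⟩
      · exact .inr ⟨t, ⟨ht, hx⟩, rfl⟩
    · rintro (hx | ⟨t, ht, rfl⟩)
      exacts [hx.1, ht.2]
  have hUc : (U : Set G).Pairwise Commute :=
    (h.sdiff_union_image_inv hTS).pairwise_commute.mono (by exact_mod_cast hU)
  have hTc : (T : Set G).Pairwise Commute := hc.mono (by exact_mod_cast hTS)
  have hd : Disjoint (U ∩ (S \ T)) ((T.filter (·⁻¹ ∈ U)).image (·⁻¹)) := by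
    rw [Finset.disjoint_left]
    intro x hx hx'
    simp only [Finset.mem_sdiff, Finset.mem_image, Finset.mem_inter, Finset.mem_filter] at hx hx'
    obtain ⟨t, ht, rfl⟩ := hx'
    exact hx.2.2 (by rw [h.eq_of_inv_mem (hTS ht.1) hx.2.1]; exact ht.1)
  have hPU : finsetProd U =
      finsetProd (U ∩ (S \ T)) * (finsetProd (T.filter (·⁻¹ ∈ U)))⁻¹ := by
    rw [← finsetProd_image_inv (hTc.mono (by exact_mod_cast Finset.filter_subset _ T)), ← finsetProd_union (hUeq ▸ hUc) hd, ← hUeq]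
  have hTeq : T.filter (·⁻¹ ∈ U) ∪ T.filter (·⁻¹ ∉ U) = T :=
    Finset.filter_union_filter_not_eq _ _
  have hPT : finsetProd T =
      finsetProd (T.filter (·⁻¹ ∈ U)) * finsetProd (T.filter (·⁻¹ ∉ U)) := by
    rw [← finsetProd_union (by rwa [hTeq]) (Finset.disjoint_filter_filter_not _ _ _), hTeq]
  rw [hPU, hPT, mul_assoc, inv_mul_cancel_left, finsetProd_union]
  · refine hc.mono ?_
    intro x hx
    simp only [Finset.coe_union, Set.mem_union, Finset.mem_coe, Finset.mem_inter,
      Finset.mem_sdiff, Finset.mem_filter] at hx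
    exact hx.elim (·.2.1) (hTS ·.1)
  · rw [Finset.disjoint_left]
    grind

/-- Lemma 3.1: for `T ⊆ S`, the set `S_T = (S \ T) ∪ T⁻¹` is pre-cubic whenever `S`
is pre-cubic, and cubic whenever `S` is cubic. -/
theorem glidingSystem_precubic_cubic_inv {G : Type*} [Group G] [DecidableEq G]
    (GS : GlidingSystem G) (S T : Finset G) (hTS : T ⊆ S) :
    (IsPreCubic GS S → IsPreCubic GS ((S \ T) ∪ T.image (·⁻¹))) ∧
      (IsCubic GS S → IsCubic GS ((S \ T) ∪ T.image (·⁻¹))) := by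
  refine ⟨fun h => h.sdiff_union_image_inv hTS, fun h => ⟨h.1.sdiff_union_image_inv hTS, ?_⟩⟩
  intro U₁ hU₁ U₂ hU₂ hne heq
  have hsub : ∀ U : Finset G, U ∩ (S \ T) ∪ T.filter (·⁻¹ ∉ U) ⊆ S := fun U x hx => by
    have := @hTS x
    grind
  refine h.2 _ (hsub U₁) _ (hsub U₂) (fun hV => hne ?_) ?_
  · have hS : ∀ s ∈ S \ T, (s ∈ U₁ ↔ s ∈ U₂) := fun s hs => by
      have := Finset.ext_iff.1 hV s
      grind
    have hT : ∀ t ∈ T, (t⁻¹ ∈ U₁ ↔ t⁻¹ ∈ U₂) := fun t ht => by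
      have := Finset.ext_iff.1 hV t
      grind
    have key : ∀ x ∈ (S \ T) ∪ T.image (·⁻¹), (x ∈ U₁ ↔ x ∈ U₂) := by
      intro x hx
      obtain hx | hx := Finset.mem_union.1 hx
      · exact hS x hx
      · obtain ⟨t, ht, rfl⟩ := Finset.mem_image.1 hx
        exact hT t ht
    ext x
    exact ⟨fun hx => (key x (hU₁ hx)).1 hx, fun hx => (key x (hU₂ hx)).2 hx⟩
  · rw [← h.1.finsetProd_mul_finsetProd hTS hU₁, ← h.1.finsetProd_mul_finsetProd hTS hU₂, heq]
end

section
/- Let E be a set and H a group, and consider the group H^E of all maps E → H with pointwise multiplication. Let S be a finite set of non-identity elements of H^E whose supports are pairwise disjoint, where the support of f : E → H is {e ∈ E | f(e) ≠ 1}. Then for any two distinct subsets T₁, T₂ ⊆ S, the pointwise products ∏_{f ∈ T₁} f and ∏_{f ∈ T₂} f are distinct elements of H^E. -/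
/-- The support of a map `f : E → H` to a group `H` is the set of points where `f`
is not the identity. -/
def mapSupport {E H : Type*} [Group H] (f : E → H) : Set E := {e | f e ≠ 1}

theorem commute_of_disjoint_mapSupport {E H : Type*} [Group H] {f g : E → H}
    (h : Disjoint (mapSupport f) (mapSupport g)) : Commute f g := by
  funext e
  by_cases hf : f e = 1
  · simp [hf]
  · have hg : g e = 1 := by
      by_contra hg
      exact Set.disjoint_left.1 h hf hg
    simp [hg]

theorem noncommProd_id_apply_eq_one {E H : Type*} [Group H] (T : Finset (E → H))
    (comm : (T : Set (E → H)).Pairwise Commute) {e : E} (h : ∀ g ∈ T, g e = 1) :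
    T.noncommProd id comm e = 1 :=
  T.noncommProd_induction id comm (fun u => u e = 1)
    (fun a b ha hb => by simp [ha, hb]) rfl h

/-- At a point of the support of `f ∈ S`, the product of `T ⊆ S` is nontrivial
exactly when `f` is a factor. -/
theorem finsetProd_apply_ne_one_iff {E H : Type*} [Group H] {S T : Finset (E → H)}
    (hdisj : (S : Set (E → H)).Pairwise fun f g => Disjoint (mapSupport f) (mapSupport g))
    (hT : T ⊆ S) {f : E → H} (hf : f ∈ S) {e : E} (he : f e ≠ 1) :
    finsetProd T e ≠ 1 ↔ f ∈ T := by
  classical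
  have comm : (T : Set (E → H)).Pairwise Commute := fun a ha b hb hab =>
    commute_of_disjoint_mapSupport (hdisj (hT ha) (hT hb) hab)
  have key : ∀ g ∈ T, g ≠ f → g e = 1 := fun g hg hgf => by
    by_contra hge
    exact Set.disjoint_left.1 (hdisj (hT hg) hf hgf) hge he
  rw [finsetProd, dif_pos comm]
  constructor
  · intro h
    by_contra hfT
    exact h (noncommProd_id_apply_eq_one T comm fun g hg =>
      key g hg fun hgf => hfT (hgf ▸ hg))
  · intro hfT
    have comm' : (↑(T.erase f) : Set (E → H)).Pairwise Commute :=
      comm.mono (Finset.coe_subset.2 (T.erase_subset f))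
    have hone := noncommProd_id_apply_eq_one (T.erase f) comm' fun g hg =>
      key g (Finset.mem_of_mem_erase hg) (Finset.ne_of_mem_erase hg)
    have hmul : (T.erase f).noncommProd id comm' e * f e = T.noncommProd id comm e :=
      congrFun (T.noncommProd_erase_mul hfT id comm comm') e
    rwa [← hmul, hone, one_mul]

/-- Lemma 3.2: if `S` is a finite set of non-identity elements of the group `H^E`
(pointwise multiplication) with pairwise disjoint supports, then distinct subsets
of `S` have distinct (pointwise) products. -/
theorem prod_injective_of_disjoint_supports {E H : Type*} [Group H]
    (S : Finset (E → H)) (hne : ∀ f ∈ S, f ≠ 1)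
    (hdisj : (S : Set (E → H)).Pairwise fun f g => Disjoint (mapSupport f) (mapSupport g)) :
    ∀ T₁ ⊆ S, ∀ T₂ ⊆ S, T₁ ≠ T₂ → finsetProd T₁ ≠ finsetProd T₂ := by
  intro T₁ h₁ T₂ h₂ hT h
  refine hT (Finset.ext fun f => ?_)
  by_cases hf : f ∈ S
  · obtain ⟨e, he⟩ := Function.ne_iff.1 (hne f hf)
    rw [← finsetProd_apply_ne_one_iff hdisj h₁ hf he, h,
      finsetProd_apply_ne_one_iff hdisj h₂ hf he]
  · exact iff_of_false (fun hm => hf (h₁ hm)) (fun hm => hf (h₂ hm))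
end

section
/- Let A be a perfect matching in a graph and let s, t be even cycles with ∂s ∩ ∂t = ∅ such that s Δ A and t Δ A are perfect matchings. Then s Δ (t Δ A) is a perfect matching. -/
open scoped symmDiff

variable {V E : Type*}

/-- The set of vertices of a set `s` of edges. -/
def bdry (ends : E → Finset V) (s : Set E) : Set V := ⋃ e ∈ s, (ends e : Set V)

/-- A set `s` of edges is cyclic if it is finite and every vertex of `s` is incident
to exactly two edges of `s`. -/
def IsCyclicSet (ends : E → Finset V) (s : Set E) : Prop :=
  s.Finite ∧ ∀ v ∈ bdry ends s, {e ∈ s | v ∈ ends e}.ncard = 2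

/-- A cycle is a nonempty cyclic set of edges whose only nonempty cyclic subset is
itself. -/
def IsCycle (ends : E → Finset V) (s : Set E) : Prop :=
  IsCyclicSet ends s ∧ s.Nonempty ∧
    ∀ t : Set E, t ⊆ s → IsCyclicSet ends t → t.Nonempty → t = s

/-- An even cycle is a cycle with an even number of edges. -/
def IsEvenCycle (ends : E → Finset V) (s : Set E) : Prop :=
  IsCycle ends s ∧ Even s.ncard

/-- A matching: distinct edges share no vertices. -/
def IsMatchingSet (ends : E → Finset V) (A : Set E) : Prop :=
  ∀ e ∈ A, ∀ f ∈ A, e ≠ f → Disjoint (ends e : Set V) (ends f : Set V)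

/-- A perfect matching: every vertex is incident to exactly one edge of `A`. -/
def IsPerfectMatching (ends : E → Finset V) (A : Set E) : Prop :=
  ∀ v : V, ∃! e : E, e ∈ A ∧ v ∈ ends e

/-- `h` is a half of the even cycle `s` if `h` and `s \ h` are matchings. -/
def IsHalf (ends : E → Finset V) (h s : Set E) : Prop :=
  h ⊆ s ∧ IsMatchingSet ends h ∧ IsMatchingSet ends (s \ h)

/-- `B` is obtained from `A` by gliding along the even cycle `s`. -/
def IsGliding (ends : E → Finset V) (s A B : Set E) : Prop :=
  IsEvenCycle ends s ∧ IsHalf ends (A ∩ s) s ∧ B = s ∆ A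

theorem notMem_of_notMem_bdry {ends : E → Finset V} {s : Set E} {v : V} (hv : v ∉ bdry ends s)
    {e : E} (he : v ∈ ends e) : e ∉ s := fun hes =>
  hv (Set.mem_biUnion hes he)

/-- The square condition of Lemma 6.2: if `A`, `s Δ A` and `t Δ A` are perfect
matchings and `s, t` are independent even cycles, then `s Δ (t Δ A)` is a perfect
matching. -/
theorem perfectMatching_square_condition (ends : E → Finset V)
    (hcard : ∀ e, (ends e).card = 2) (A s t : Set E)
    (hA : IsPerfectMatching ends A)
    (hs : IsEvenCycle ends s) (ht : IsEvenCycle ends t)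
    (hind : bdry ends s ∩ bdry ends t = ∅)
    (hsA : IsPerfectMatching ends (s ∆ A)) (htA : IsPerfectMatching ends (t ∆ A)) :
    IsPerfectMatching ends (s ∆ (t ∆ A)) := by
  intro v
  by_cases hv : v ∈ bdry ends s
  · have hvt : v ∉ bdry ends t := Set.disjoint_left.mp (Set.disjoint_iff_inter_eq_empty.mpr hind) hv
    refine (existsUnique_congr fun e => and_congr_left fun he => ?_).mp (hsA v)
    simp [Set.mem_symmDiff, notMem_of_notMem_bdry hvt he]
  · refine (existsUnique_congr fun e => and_congr_left fun he => ?_).mp (htA v)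
    simp [Set.mem_symmDiff, notMem_of_notMem_bdry hv he]
end

section
/- Let s be a cyclic set of edges in a hypergraph. Then the cycles contained in s are pairwise independent and s is their disjoint union. -/
open scoped symmDiff

variable {V E : Type*}

/-- The set of vertices of a set `s` of edges in a hypergraph. -/
def hbdry (bd : E → Set V) (s : Set E) : Set V := ⋃ e ∈ s, bd e

/-- A set `s` of edges of a hypergraph is cyclic if it is finite and every vertex is
incident to either no edge of `s` or exactly two edges of `s`. -/
def HIsCyclicSet (bd : E → Set V) (s : Set E) : Prop :=
  s.Finite ∧ ∀ v : V, {e ∈ s | v ∈ bd e} = ∅ ∨ {e ∈ s | v ∈ bd e}.ncard = 2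

/-- A cycle in a hypergraph: a nonempty cyclic set of edges whose only nonempty
cyclic subset is itself. -/
def HIsCycle (bd : E → Set V) (s : Set E) : Prop :=
  HIsCyclicSet bd s ∧ s.Nonempty ∧
    ∀ t : Set E, t ⊆ s → HIsCyclicSet bd t → t.Nonempty → t = s

/-- A matching in a hypergraph: distinct edges have disjoint boundaries. -/
def HIsMatching (bd : E → Set V) (A : Set E) : Prop :=
  ∀ e ∈ A, ∀ f ∈ A, e ≠ f → bd e ∩ bd f = ∅

/-- Inside a cyclic set, a cyclic subset contains every edge meeting one of its edges. -/
theorem HIsCyclicSet.mem_of_subset {bd : E → Set V} {s t : Set E} (hs : HIsCyclicSet bd s)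
    (ht : HIsCyclicSet bd t) (hts : t ⊆ s) {e f : E} {v : V} (he : e ∈ t) (hf : f ∈ s)
    (hve : v ∈ bd e) (hvf : v ∈ bd f) : f ∈ t := by
  have hsub : {e ∈ t | v ∈ bd e} ⊆ {e ∈ s | v ∈ bd e} := fun x hx => ⟨hts hx.1, hx.2⟩
  have ht2 : {e ∈ t | v ∈ bd e}.ncard = 2 :=
    (ht.2 v).resolve_left (Set.Nonempty.ne_empty ⟨e, he, hve⟩)
  have hs2 : {e ∈ s | v ∈ bd e}.ncard = 2 :=
    (hs.2 v).resolve_left (Set.Nonempty.ne_empty ⟨f, hf, hvf⟩)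
  have heq := Set.eq_of_subset_of_ncard_le hsub (by rw [hs2, ht2])
    (hs.1.subset fun x hx => hx.1)
  have hmem : f ∈ {e ∈ t | v ∈ bd e} := heq ▸ ⟨hf, hvf⟩
  exact hmem.1

/-- A subset of a cyclic set that is closed under meeting edges is cyclic. -/
theorem HIsCyclicSet.of_saturated {bd : E → Set V} {s t : Set E} (hs : HIsCyclicSet bd s)
    (hts : t ⊆ s)
    (h : ∀ e ∈ t, ∀ f ∈ s, ∀ v, v ∈ bd e → v ∈ bd f → f ∈ t) : HIsCyclicSet bd t := by
  refine ⟨hs.1.subset hts, fun v => ?_⟩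
  rcases Set.eq_empty_or_nonempty {e ∈ t | v ∈ bd e} with h0 | ⟨e, het, hev⟩
  · exact Or.inl h0
  · have heq : {e ∈ t | v ∈ bd e} = {e ∈ s | v ∈ bd e} :=
      Set.Subset.antisymm (fun x hx => ⟨hts hx.1, hx.2⟩)
        fun x hx => ⟨h e het x hx.1 v hev hx.2, hx.2⟩
    rw [heq]
    exact hs.2 v

theorem HIsCyclicSet.inter {bd : E → Set V} {s t u : Set E} (hs : HIsCyclicSet bd s)
    (ht : HIsCyclicSet bd t) (hu : HIsCyclicSet bd u) (hts : t ⊆ s) (hus : u ⊆ s) :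
    HIsCyclicSet bd (t ∩ u) :=
  hs.of_saturated (fun _ hx => hts hx.1) fun _ he _ hf _ hve hvf =>
    ⟨hs.mem_of_subset ht hts he.1 hf hve hvf, hs.mem_of_subset hu hus he.2 hf hve hvf⟩

theorem HIsCyclicSet.sdiff {bd : E → Set V} {s t : Set E} (hs : HIsCyclicSet bd s)
    (ht : HIsCyclicSet bd t) (hts : t ⊆ s) : HIsCyclicSet bd (s \ t) :=
  hs.of_saturated Set.sdiff_subset fun _ he _ hf _ hve hvf =>
    ⟨hf, fun hft => he.2 (hs.mem_of_subset ht hts hft he.1 hvf hve)⟩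

/-- Every edge of a cyclic set lies in a cycle contained in that set. -/
theorem HIsCyclicSet.exists_isCycle_mem {bd : E → Set V} {s : Set E} (hs : HIsCyclicSet bd s)
    {e : E} (he : e ∈ s) : ∃ c ⊆ s, HIsCycle bd c ∧ e ∈ c := by
  let c : Set E := {f ∈ s | ∀ t ⊆ s, HIsCyclicSet bd t → e ∈ t → f ∈ t}
  have hcs : c ⊆ s := fun x hx => hx.1
  have hc : HIsCyclicSet bd c := hs.of_saturated hcs fun x hx f hf v hvx hvf =>
    ⟨hf, fun t hts ht het => hs.mem_of_subset ht hts (hx.2 t hts ht het) hf hvx hvf⟩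
  have hec : e ∈ c := ⟨he, fun _ _ _ het => het⟩
  refine ⟨c, hcs, ⟨hc, ⟨e, hec⟩, fun t htc ht ⟨x, hx⟩ => ?_⟩, hec⟩
  by_cases het : e ∈ t
  · exact htc.antisymm fun y hy => hy.2 t (htc.trans hcs) ht het
  · exact absurd hx
      ((htc hx).2 (c \ t) (Set.sdiff_subset.trans hcs) (hc.sdiff ht htc) ⟨hec, het⟩).2

/-- Lemma 11.1: the cycles contained in a cyclic set of edges `s` of a hypergraph
are pairwise independent and `s` is their (disjoint) union. -/
theorem hypergraph_cyclicSet_splits (bd : E → Set V)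
    (hne : ∀ e : E, (bd e).Nonempty) (hcov : ⋃ e : E, bd e = Set.univ)
    (s : Set E) (hs : HIsCyclicSet bd s) :
    ({c : Set E | c ⊆ s ∧ HIsCycle bd c}.Pairwise
        fun c d => hbdry bd c ∩ hbdry bd d = ∅) ∧
      s = ⋃₀ {c : Set E | c ⊆ s ∧ HIsCycle bd c} := by
  refine ⟨fun c hc d hd hcd => ?_, Set.Subset.antisymm (fun e he => ?_)
    (Set.sUnion_subset fun c hc => hc.1)⟩
  · by_contra h_meet
    obtain ⟨v, hvc, hvd⟩ := Set.nonempty_iff_ne_empty.mpr h_meet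
    simp only [hbdry, Set.mem_iUnion, exists_prop] at hvc hvd
    obtain ⟨e, hec, hve⟩ := hvc
    obtain ⟨f, hfd, hvf⟩ := hvd
    have hfc : f ∈ c := hs.mem_of_subset hc.2.1 hc.1 hec (hd.1 hfd) hve hvf
    have hcyc := hs.inter hc.2.1 hd.2.1 hc.1 hd.1
    exact hcd ((hc.2.2.2 _ Set.inter_subset_left hcyc ⟨f, hfc, hfd⟩).symm.trans
      (hd.2.2.2 _ Set.inter_subset_right hcyc ⟨f, hfc, hfd⟩))
  · obtain ⟨c, hcs, hc, hec⟩ := hs.exists_isCycle_mem he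
    exact ⟨c, ⟨hcs, hc⟩, hec⟩
end

section
/- Let s be a finite cyclic set of edges in a graph, and suppose s is the union of a family 𝒞 of pairwise independent cycles. Then 𝒞 is precisely the set of all cycles contained in s; in particular, a finite cyclic set of edges splits as a union of pairwise independent cycles in a unique way. -/
open scoped symmDiff

variable {V E : Type*}

theorem bdry_mono (ends : E → Finset V) {t s : Set E} (h : t ⊆ s) :
    bdry ends t ⊆ bdry ends s :=
  Set.biUnion_subset_biUnion_left h

/-- At a vertex of a cyclic subset `t` of a cyclic set `s`, all edges of `s` belong to `t`. -/
theorem IsCyclicSet.sep_eq_of_subset {ends : E → Finset V} {t s : Set E}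
    (ht : IsCyclicSet ends t) (hs : IsCyclicSet ends s) (hts : t ⊆ s) {v : V}
    (hv : v ∈ bdry ends t) : {e ∈ t | v ∈ ends e} = {e ∈ s | v ∈ ends e} := by
  refine Set.eq_of_subset_of_ncard_le (fun e he => ⟨hts he.1, he.2⟩) ?_
    (hs.1.subset (Set.sep_subset _ _))
  rw [ht.2 v hv, hs.2 v (bdry_mono ends hts hv)]

/-- Two cyclic subsets of a cyclic set have a cyclic intersection. -/
theorem IsCyclicSet.inter_of_subset {ends : E → Finset V} {c d s : Set E}
    (hc : IsCyclicSet ends c) (hd : IsCyclicSet ends d) (hs : IsCyclicSet ends s)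
    (hcs : c ⊆ s) (hds : d ⊆ s) : IsCyclicSet ends (c ∩ d) := by
  refine ⟨hc.1.subset Set.inter_subset_left, fun v hv => ?_⟩
  have hvc := bdry_mono ends Set.inter_subset_left hv
  have hvd := bdry_mono ends Set.inter_subset_right hv
  have hcd : {e ∈ c | v ∈ ends e} = {e ∈ d | v ∈ ends e} :=
    (hc.sep_eq_of_subset hs hcs hvc).trans (hd.sep_eq_of_subset hs hds hvd).symm
  have h : {e ∈ c ∩ d | v ∈ ends e} = {e ∈ c | v ∈ ends e} := by
    rw [← Set.inter_self {e ∈ c | v ∈ ends e}]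
    nth_rewrite 2 [hcd]
    exact Set.inter_inter_distrib_right c d {e | v ∈ ends e}
  rw [h, hc.2 v hvc]

/-- Two cycles contained in a cyclic set are equal as soon as they share an edge. -/
theorem IsCycle.eq_of_mem_of_mem {ends : E → Finset V} {c d s : Set E}
    (hc : IsCycle ends c) (hd : IsCycle ends d) (hs : IsCyclicSet ends s)
    (hcs : c ⊆ s) (hds : d ⊆ s) {e : E} (hec : e ∈ c) (hed : e ∈ d) : c = d :=
  have h := hc.1.inter_of_subset hd.1 hs hcs hds
  (hc.2.2 _ Set.inter_subset_left h ⟨e, hec, hed⟩).symm.trans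
    (hd.2.2 _ Set.inter_subset_right h ⟨e, hec, hed⟩)

/-- Uniqueness of the splitting of a finite cyclic set of edges into pairwise
independent cycles: any family of pairwise independent cycles with union `s` is
exactly the set of all cycles contained in `s` (used in Lemma 7.2 and
Theorem 10.2). -/
theorem cyclicSet_splitting_unique (ends : E → Finset V)
    (hcard : ∀ e, (ends e).card = 2) (s : Set E) (hs : IsCyclicSet ends s)
    (𝒞 : Set (Set E)) (hcyc : ∀ c ∈ 𝒞, IsCycle ends c)
    (hind : 𝒞.Pairwise fun c d => bdry ends c ∩ bdry ends d = ∅)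
    (huni : ⋃₀ 𝒞 = s) :
    𝒞 = {c : Set E | c ⊆ s ∧ IsCycle ends c} := by
  subst huni
  ext c
  refine ⟨fun hc => ⟨Set.subset_sUnion_of_mem hc, hcyc c hc⟩, fun ⟨hcs, hc⟩ => ?_⟩
  obtain ⟨e, hec⟩ := hc.2.1
  obtain ⟨d, hd, hed⟩ := hcs hec
  rwa [hc.eq_of_mem_of_mem (hcyc d hd) hs hcs (Set.subset_sUnion_of_mem hd) hec hed]
end

section
/- In a finite graph (finitely many vertices and edges), any two perfect matchings A and B can be joined by a finite sequence A = A₀, A₁, …, A_n = B of perfect matchings in which each A_{k+1} is obtained from A_k by gliding along an even cycle. -/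
open scoped symmDiff

variable {V E : Type*}

theorem mem_bdry {ends : E → Finset V} {s : Set E} {v : V} :
    v ∈ bdry ends s ↔ ∃ e ∈ s, v ∈ ends e := by
  simp [bdry]

theorem IsMatchingSet.mono {ends : E → Finset V} {M N : Set E} (hN : IsMatchingSet ends N)
    (h : M ⊆ N) : IsMatchingSet ends M :=
  fun e he f hf hne => hN e (h he) f (h hf) hne

theorem IsPerfectMatching.isMatchingSet {ends : E → Finset V} {A : Set E}
    (hA : IsPerfectMatching ends A) : IsMatchingSet ends A := by
  intro e he f hf hne
  refine Set.disjoint_left.2 fun v hve hvf => hne ?_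
  exact (hA v).unique ⟨he, hve⟩ ⟨hf, hvf⟩

/-- In a graph, a finite matching covers twice as many vertices as it has edges. -/
theorem IsMatchingSet.ncard_bdry {ends : E → Finset V} (hcard : ∀ e, (ends e).card = 2)
    {M : Set E} (hM : IsMatchingSet ends M) (hfin : M.Finite) :
    (bdry ends M).ncard = 2 * M.ncard := by
  classical
  lift M to Finset E using hfin
  have hb : bdry ends (M : Set E) = (M.biUnion ends : Finset V) := by
    ext v
    simp [mem_bdry]
  rw [hb, Set.ncard_coe_finset, Set.ncard_coe_finset, Finset.card_biUnion]
  · simp [hcard, mul_comm]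
  · intro e he f hf hne
    exact_mod_cast hM e he f hf hne

/-- Each vertex of a cyclic subset `s` of the symmetric difference of two perfect matchings
lies on exactly one edge of `s` from each of them. -/
theorem IsCyclicSet.exists_edge_pair {ends : E → Finset V} {A B s : Set E}
    (hA : IsPerfectMatching ends A) (hB : IsPerfectMatching ends B) (hs : IsCyclicSet ends s)
    (hsub : s ⊆ A ∆ B) {v : V} (hv : v ∈ bdry ends s) :
    ∃ e ∈ s ∩ A, ∃ f ∈ s \ A, v ∈ ends e ∧ v ∈ ends f ∧
      ∀ g ∈ s, v ∈ ends g → g = e ∨ g = f := by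
  obtain ⟨x, y, hxy, heq⟩ := Set.ncard_eq_two.1 (hs.2 v hv)
  have hall : ∀ g, (g ∈ s ∧ v ∈ ends g) ↔ g = x ∨ g = y := fun g => by
    simpa using Set.ext_iff.1 heq g
  obtain ⟨hxs, hxv⟩ := (hall x).2 (Or.inl rfl)
  obtain ⟨hys, hyv⟩ := (hall y).2 (Or.inr rfl)
  rcases hsub hxs with ⟨hxA, -⟩ | ⟨hxB, hxA⟩
  · have hyA : y ∉ A := fun h => hxy ((hA v).unique ⟨hxA, hxv⟩ ⟨h, hyv⟩)
    exact ⟨x, ⟨hxs, hxA⟩, y, ⟨hys, hyA⟩, hxv, hyv, fun g hg hgv => (hall g).1 ⟨hg, hgv⟩⟩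
  · rcases hsub hys with ⟨hyA, -⟩ | ⟨hyB, -⟩
    · exact ⟨y, ⟨hys, hyA⟩, x, ⟨hxs, hxA⟩, hyv, hxv,
        fun g hg hgv => ((hall g).1 ⟨hg, hgv⟩).symm⟩
    · exact absurd ((hB v).unique ⟨hxB, hxv⟩ ⟨hyB, hyv⟩) hxy

theorem IsPerfectMatching.isCyclicSet_symmDiff [Finite E] {ends : E → Finset V} {A B : Set E}
    (hA : IsPerfectMatching ends A) (hB : IsPerfectMatching ends B) :
    IsCyclicSet ends (A ∆ B) := by
  refine ⟨Set.toFinite _, fun v hv => ?_⟩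
  obtain ⟨g, hg, hgv⟩ := mem_bdry.1 hv
  obtain ⟨a, ⟨haA, hav⟩, ha⟩ := hA v
  obtain ⟨b, ⟨hbB, hbv⟩, hb⟩ := hB v
  have hab : a ≠ b := by
    rintro rfl
    rcases hg with ⟨h, h'⟩ | ⟨h, h'⟩
    · exact h' (ha g ⟨h, hgv⟩ ▸ hbB)
    · exact h' (hb g ⟨h, hgv⟩ ▸ haA)
  have haB : a ∉ B := fun h => hab (hb a ⟨h, hav⟩)
  have hbA : b ∉ A := fun h => hab (ha b ⟨h, hbv⟩).symm
  refine Set.ncard_eq_two.2 ⟨a, b, hab, Set.ext fun e => ⟨?_, ?_⟩⟩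
  · rintro ⟨⟨h, -⟩ | ⟨h, -⟩, hev⟩
    · exact Or.inl (ha e ⟨h, hev⟩)
    · exact Or.inr (hb e ⟨h, hev⟩)
  · rintro (rfl | rfl)
    · exact ⟨Or.inl ⟨haA, haB⟩, hav⟩
    · exact ⟨Or.inr ⟨hbB, hbA⟩, hbv⟩

theorem IsCyclicSet.exists_isCycle_subset [Finite E] {ends : E → Finset V} {t : Set E}
    (ht : IsCyclicSet ends t) (hne : t.Nonempty) : ∃ s ⊆ t, IsCycle ends s := by
  obtain ⟨s, hst, hs⟩ := exists_minimal_le_of_wellFoundedLT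
    (fun s : Set E => IsCyclicSet ends s ∧ s.Nonempty) t ⟨ht, hne⟩
  exact ⟨s, hst, hs.prop.1, hs.prop.2, fun r hrs hr hrne => hs.eq_of_le ⟨hr, hrne⟩ hrs⟩

/-- A cyclic subset of the symmetric difference of two perfect matchings has an even number
of edges. -/
theorem IsCyclicSet.even_ncard {ends : E → Finset V} (hcard : ∀ e, (ends e).card = 2)
    {A B s : Set E} (hA : IsPerfectMatching ends A) (hB : IsPerfectMatching ends B)
    (hs : IsCyclicSet ends s) (hsub : s ⊆ A ∆ B) : Even s.ncard := by
  have hdiff : s \ A ⊆ B := fun e he => (hsub he.1).elim (fun h => absurd h.1 he.2) And.left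
  have h₁ := (hA.isMatchingSet.mono (Set.inter_subset_right (s := s))).ncard_bdry hcard
    (hs.1.subset Set.inter_subset_left)
  have h₂ := (hB.isMatchingSet.mono hdiff).ncard_bdry hcard (hs.1.subset Set.sdiff_subset)
  have hb : bdry ends (s ∩ A) = bdry ends (s \ A) := by
    ext v
    constructor <;> intro hv <;> obtain ⟨g, hg, hgv⟩ := mem_bdry.1 hv <;>
      obtain ⟨e, he, f, hf, hev, hfv, -⟩ :=
        hs.exists_edge_pair hA hB hsub (mem_bdry.2 ⟨g, hg.1, hgv⟩)
    · exact mem_bdry.2 ⟨f, hf, hfv⟩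
    · exact mem_bdry.2 ⟨e, he, hev⟩
  rw [hb] at h₁
  have h₃ := Set.ncard_inter_add_ncard_sdiff_eq_ncard s A hs.1
  exact ⟨(s ∩ A).ncard, by omega⟩

theorem IsCyclicSet.isPerfectMatching_symmDiff {ends : E → Finset V} {A B s : Set E}
    (hA : IsPerfectMatching ends A) (hB : IsPerfectMatching ends B) (hs : IsCyclicSet ends s)
    (hsub : s ⊆ A ∆ B) : IsPerfectMatching ends (s ∆ A) := by
  intro v
  by_cases hv : v ∈ bdry ends s
  · obtain ⟨e, he, f, hf, hev, hfv, hall⟩ := hs.exists_edge_pair hA hB hsub hv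
    refine ⟨f, ⟨Or.inl hf, hfv⟩, ?_⟩
    rintro g ⟨⟨hgs, hgA⟩ | ⟨hgA, hgs⟩, hgv⟩
    · exact (hall g hgs hgv).resolve_left fun h => hgA (h ▸ he.2)
    · exact absurd ((hA v).unique ⟨he.2, hev⟩ ⟨hgA, hgv⟩ ▸ he.1) hgs
  · obtain ⟨a, ⟨haA, hav⟩, ha⟩ := hA v
    refine ⟨a, ⟨Or.inr ⟨haA, fun h => hv (mem_bdry.2 ⟨a, h, hav⟩)⟩, hav⟩, ?_⟩
    rintro g ⟨⟨hgs, -⟩ | ⟨hgA, -⟩, hgv⟩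
    · exact absurd (mem_bdry.2 ⟨g, hgs, hgv⟩) hv
    · exact ha g ⟨hgA, hgv⟩

theorem IsCycle.isGliding_symmDiff {ends : E → Finset V} (hcard : ∀ e, (ends e).card = 2)
    {A B s : Set E} (hA : IsPerfectMatching ends A) (hB : IsPerfectMatching ends B)
    (hs : IsCycle ends s) (hsub : s ⊆ A ∆ B) : IsGliding ends s A (s ∆ A) := by
  refine ⟨⟨hs, hs.1.even_ncard hcard hA hB hsub⟩, ⟨Set.inter_subset_right,
    hA.isMatchingSet.mono Set.inter_subset_left, hB.isMatchingSet.mono ?_⟩, rfl⟩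
  rintro e ⟨hes, hn⟩
  exact (hsub hes).elim (fun h => absurd ⟨h.1, hes⟩ hn) And.left

/-- Lemma 6.5: in a finite graph, any two perfect matchings can be joined by a
finite sequence of glidings along even cycles through perfect matchings. -/
theorem perfectMatchings_glide_chain_of_finite [Finite V] [Finite E]
    (ends : E → Finset V) (hcard : ∀ e, (ends e).card = 2) (A B : Set E)
    (hA : IsPerfectMatching ends A) (hB : IsPerfectMatching ends B) :
    ∃ (n : ℕ) (f : ℕ → Set E), f 0 = A ∧ f n = B ∧
      (∀ k ≤ n, IsPerfectMatching ends (f k)) ∧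
      ∀ k < n, ∃ s : Set E, IsGliding ends s (f k) (f (k + 1)) := by
  obtain ⟨m, hm⟩ : ∃ m, (A ∆ B).ncard = m := ⟨_, rfl⟩
  induction m using Nat.strong_induction_on generalizing A with
  | h m ih =>
    rcases (A ∆ B).eq_empty_or_nonempty with hAB | hAB
    · exact ⟨0, fun _ => A, rfl, symmDiff_eq_bot.1 hAB, fun _ _ => hA,
        fun k hk => absurd hk k.not_lt_zero⟩
    obtain ⟨s, hsub, hs⟩ := (hA.isCyclicSet_symmDiff hB).exists_isCycle_subset hAB
    have hlt : ((s ∆ A) ∆ B).ncard < m := by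
      rw [← hm, symmDiff_assoc, Set.symmDiff_def, Set.sdiff_eq_empty.2 hsub, Set.empty_union]
      exact Set.ncard_lt_ncard (sdiff_lt hsub hs.2.1.ne_empty)
    have hA' := hs.1.isPerfectMatching_symmDiff hA hB hsub
    obtain ⟨n, f, hf0, hfn, hfp, hfg⟩ := ih _ hlt (s ∆ A) hA' rfl
    refine ⟨n + 1, fun k => Nat.casesOn k A f, rfl, hfn, ?_, ?_⟩
    · rintro (_ | k) hk
      · exact hA
      · exact hfp k (Nat.le_of_succ_le_succ hk)
    · rintro (_ | k) hk
      · refine ⟨s, ?_⟩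
        simpa [hf0] using hs.isGliding_symmDiff hcard hA hB hsub
      · exact hfg k (Nat.lt_of_succ_lt_succ hk)
end

section
/- Let Γ be a finite graph with edge set E and let A and B be perfect matchings of Γ. Then the characteristic functions χ_A and χ_B lie in the same path component of the space L of dimer labelings of Γ: there exists a continuous map γ : [0,1] → ℝ^E with γ(u) ∈ L for all u, γ(0) = χ_A, and γ(1) = χ_B. -/
open scoped symmDiff

variable {V E : Type*}

/-- A dimer labeling: a labeling of the edges by nonnegative reals such that at
every vertex exactly one or two incident edges carry a nonzero label, and the sum
of the labels of the incident edges equals `1`. -/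
def IsDimerLabeling (ends : E → Finset V) (l : E → ℝ) : Prop :=
  (∀ e, 0 ≤ l e) ∧ ∀ v : V,
    ({e : E | v ∈ ends e ∧ l e ≠ 0}.ncard = 1 ∨
      {e : E | v ∈ ends e ∧ l e ≠ 0}.ncard = 2) ∧
    ∑ᶠ e ∈ {e : E | v ∈ ends e ∧ l e ≠ 0}, l e = 1

/-- A convex combination of the characteristic functions of two perfect matchings is a
dimer labeling. -/
theorem isDimerLabeling_convexCombination [Finite E] {ends : E → Finset V} {A B : Set E}
    (hA : IsPerfectMatching ends A) (hB : IsPerfectMatching ends B) {s t : ℝ}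
    (hs : 0 ≤ s) (ht : 0 ≤ t) (hst : s + t = 1) :
    IsDimerLabeling ends
      (s • A.indicator (fun _ => (1 : ℝ)) + t • B.indicator (fun _ => (1 : ℝ))) := by
  classical
  cases nonempty_fintype E
  set l : E → ℝ := s • A.indicator (fun _ => (1 : ℝ)) + t • B.indicator (fun _ => (1 : ℝ))
    with hl
  have hl_apply : ∀ e, l e = (if e ∈ A then s else 0) + (if e ∈ B then t else 0) := by
    intro e
    simp [hl, Set.indicator_apply]
  refine ⟨fun e => ?_, fun v => ?_⟩
  · rw [hl_apply]
    split_ifs <;> linarith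
  obtain ⟨a, ⟨haA, hav⟩, ha⟩ := hA v
  obtain ⟨b, ⟨hbB, hbv⟩, hb⟩ := hB v
  have hl_incident : ∀ e, v ∈ ends e →
      l e = (if e = a then s else 0) + (if e = b then t else 0) := by
    intro e he
    have h₁ : e ∈ A ↔ e = a := ⟨fun h => ha e ⟨h, he⟩, fun h => h ▸ haA⟩
    have h₂ : e ∈ B ↔ e = b := ⟨fun h => hb e ⟨h, he⟩, fun h => h ▸ hbB⟩
    simp only [hl_apply, h₁, h₂]
  set S : Set E := {e | v ∈ ends e ∧ l e ≠ 0}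
  have hsub : S ⊆ ({a, b} : Finset E) := by
    rintro e ⟨he, hne⟩
    rw [hl_incident e he] at hne
    by_contra h
    simp only [Finset.coe_insert, Finset.coe_singleton, Set.mem_insert_iff,
      Set.mem_singleton_iff, not_or] at h
    simp [h] at hne
  have hsum : ∑ᶠ e ∈ S, l e = 1 := by
    have hS : S = {e | v ∈ ends e} ∩ Function.support l := rfl
    rw [hS, finsum_mem_inter_support, finsum_mem_eq_finite_toFinset_sum _ (Set.toFinite _),
      Finset.sum_congr rfl fun e he => hl_incident e (by simpa using he)]
    simp [Finset.sum_add_distrib, hav, hbv, hst]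
  have hle : S.ncard ≤ 2 := by
    refine (Set.ncard_le_ncard hsub).trans ?_
    rw [Set.ncard_coe_finset]
    exact Finset.card_le_two
  have hpos : 0 < S.ncard := by
    rw [Set.ncard_pos, Set.nonempty_iff_ne_empty]
    intro h
    simp [h] at hsum
  exact ⟨by omega, hsum⟩

/-- Theorem 10.2(i): the characteristic functions of any two perfect matchings of
a finite graph lie in the same path component of the space of dimer labelings. -/
theorem perfectMatchings_joined_in_dimerLabelings [Fintype V] [Fintype E]
    (ends : E → Finset V) (hcard : ∀ e, (ends e).card = 2) (A B : Set E)
    (hA : IsPerfectMatching ends A) (hB : IsPerfectMatching ends B) :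
    JoinedIn {l : E → ℝ | IsDimerLabeling ends l}
      (A.indicator fun _ => (1 : ℝ)) (B.indicator fun _ => (1 : ℝ)) := by
  refine JoinedIn.of_segment_subset ?_
  rintro _ ⟨s, t, hs, ht, hst, rfl⟩
  exact isDimerLabeling_convexCombination hA hB hs ht hst
end

section
/- Let ℓ be a dimer labeling of a graph and let s be a cycle with an odd number of edges such that for every vertex v ∈ ∂s, the edges incident to v carrying a nonzero label are exactly the two edges of s incident to v. Then ℓ(e) = 1/2 for every e ∈ s. -/
open scoped symmDiff

variable {V E : Type*}

/-- At each endpoint `v` of an edge `e` of the cyclic set `s`, there is exactly one other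
edge of `s`, and its label is `1 - l e`. -/
theorem exists_other_edge_label (ends : E → Finset V) (l : E → ℝ)
    (hl : IsDimerLabeling ends l) (s : Set E) (hs : IsCyclicSet ends s)
    (hsupp : ∀ v ∈ bdry ends s,
      {e : E | v ∈ ends e ∧ l e ≠ 0} = {e ∈ s | v ∈ ends e})
    {e : E} (he : e ∈ s) {v : V} (hv : v ∈ ends e) :
    ∃ f ∈ s, f ≠ e ∧ v ∈ ends f ∧ l f = 1 - l e ∧
      ∀ g ∈ s, v ∈ ends g → g = e ∨ g = f := by
  have hvs : v ∈ bdry ends s := Set.mem_biUnion he hv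
  obtain ⟨x, y, hxy, hset⟩ := Set.ncard_eq_two.mp (hs.2 v hvs)
  have hsum := (hl.2 v).2
  rw [hsupp v hvs, hset, finsum_mem_pair hxy] at hsum
  have hmem : ∀ g, (g ∈ s ∧ v ∈ ends g) ↔ g = x ∨ g = y := fun g => by
    simpa using Set.ext_iff.mp hset g
  have hx := (hmem x).2 (Or.inl rfl)
  have hy := (hmem y).2 (Or.inr rfl)
  rcases (hmem e).1 ⟨he, hv⟩ with rfl | rfl
  · exact ⟨y, hy.1, hxy.symm, hy.2, by linarith, fun g hg hvg => (hmem g).1 ⟨hg, hvg⟩⟩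
  · exact ⟨x, hx.1, hxy, hx.2, by linarith, fun g hg hvg => ((hmem g).1 ⟨hg, hvg⟩).symm⟩

/-- A nonempty subset of a cycle that is closed under adjacency is the whole cycle. -/
theorem IsCycle.eq_of_adjacent_closed {ends : E → Finset V} {s t : Set E}
    (hs : IsCycle ends s) (hts : t ⊆ s) (ht : t.Nonempty)
    (hadj : ∀ e ∈ t, ∀ v ∈ ends e, ∀ f ∈ s, v ∈ ends f → f ∈ t) : t = s := by
  refine hs.2.2 t hts ⟨hs.1.1.subset hts, fun v hv => ?_⟩ ht
  simp only [bdry, Set.mem_iUnion, Finset.mem_coe, exists_prop] at hv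
  obtain ⟨e, he, hve⟩ := hv
  rw [← hs.1.2 v (Set.mem_biUnion (hts he) hve)]
  congr 1
  ext f
  exact ⟨fun h => ⟨hts h.1, h.2⟩, fun h => ⟨hadj e he v hve f h.1 h.2, h.2⟩⟩

/-- From the proof of Theorem 10.2: if the edges with nonzero label incident to
each vertex of an odd cycle `s` are exactly the two edges of `s` at that vertex,
then the labeling is constant `1/2` on `s`. -/
theorem dimerLabeling_odd_cycle_half (ends : E → Finset V)
    (hcard : ∀ e, (ends e).card = 2) (l : E → ℝ) (hl : IsDimerLabeling ends l)
    (s : Set E) (hs : IsCycle ends s) (hodd : Odd s.ncard)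
    (hsupp : ∀ v ∈ bdry ends s,
      {e : E | v ∈ ends e ∧ l e ≠ 0} = {e ∈ s | v ∈ ends e}) :
    ∀ e ∈ s, l e = 1 / 2 := by
  classical
  have key := fun {e : E} (he : e ∈ s) {v : V} (hv : v ∈ ends e) =>
    exists_other_edge_label ends l hl s hs.1 hsupp he hv
  intro e₀ he₀
  by_contra hne
  set a := l e₀ with ha
  have hne' : a ≠ 1 - a := fun h => hne (by linarith)
  have hall : ∀ e ∈ s, l e = a ∨ l e = 1 - a := by
    have := hs.eq_of_adjacent_closed (t := {e ∈ s | l e = a ∨ l e = 1 - a})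
      (fun e he => he.1) ⟨e₀, he₀, Or.inl rfl⟩ (by
        rintro e ⟨he, hle⟩ v hve g hg hvg
        obtain ⟨f, -, -, -, hlf, huniq⟩ := key he hve
        refine ⟨hg, ?_⟩
        rcases huniq g hg hvg with rfl | rfl
        · exact hle
        · rcases hle with h | h
          · right; rw [hlf, h]
          · left; rw [hlf, h]; ring)
    exact fun e he => (this.symm ▸ he : e ∈ {e ∈ s | l e = a ∨ l e = 1 - a}).2
  set S := hs.1.1.toFinset with hS
  have hmemS : ∀ e, e ∈ S ↔ e ∈ s := fun e => hs.1.1.mem_toFinset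
  have hcount : ∀ c : ℝ, c ≠ 1 - c →
      ((S.filter (l · = c)).biUnion ends).card = (S.filter (l · = c)).card * 2 := by
    intro c hc
    rw [Finset.card_biUnion, Finset.sum_const_nat fun e _ => hcard e]
    intro e he g hg heg
    simp only [Finset.coe_filter, Set.mem_ofPred_eq, hmemS] at he hg
    refine Finset.disjoint_left.2 fun v hve hvg => ?_
    obtain ⟨f, -, -, -, hlf, huniq⟩ := key he.1 hve
    rcases huniq g hg.1 hvg with rfl | rfl
    · exact heg rfl
    · exact hc (by linarith [he.2, hg.2])
  have hsub : ∀ c : ℝ, (S.filter (l · = c)).biUnion ends ⊆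
      (S.filter (l · = 1 - c)).biUnion ends := by
    intro c v hv
    simp only [Finset.mem_biUnion, Finset.mem_filter, hmemS] at hv ⊢
    obtain ⟨e, ⟨he, hle⟩, hve⟩ := hv
    obtain ⟨f, hf, -, hvf, hlf, -⟩ := key he hve
    exact ⟨f, ⟨hf, hle ▸ hlf⟩, hvf⟩
  have hbdry : (S.filter (l · = a)).biUnion ends = (S.filter (l · = 1 - a)).biUnion ends :=
    (hsub a).antisymm (by simpa using hsub (1 - a))
  have hA := hcount a hne'
  have hB := hcount (1 - a) (fun h => hne' (by linarith))
  rw [hbdry] at hA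
  have hfilter : S.filter (fun e => ¬ l e = a) = S.filter (l · = 1 - a) := by
    refine Finset.filter_congr fun e he => ⟨fun h => ?_, fun h h' => hne' (h' ▸ h)⟩
    exact (hall e ((hmemS e).1 he)).resolve_left h
  have hsplit := S.card_filter_add_card_filter_not (l · = a)
  rw [hfilter] at hsplit
  rw [Set.ncard_eq_toFinset_card s hs.1.1, ← hS] at hodd
  obtain ⟨k, hk⟩ := hodd
  omega
end

section
/- Let ℓ be a dimer labeling of a graph and let s be an even cycle with halves s′ and s′′ such that for every vertex v ∈ ∂s, the edges incident to v carrying a nonzero label are exactly the two edges of s incident to v. Then there exists x with 0 < x < 1 such that ℓ(e) = x for every e ∈ s′ and ℓ(e) = 1 − x for every e ∈ s′′. -/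
open scoped symmDiff

variable {V E : Type*}

/-- At a vertex of a cyclic set split into two matchings, each matching has exactly one edge,
and if the support of a dimer labeling agrees with the set there, the two labels are positive
and sum to `1`. -/
theorem IsDimerLabeling.exists_pair_of_mem_bdry {ends : E → Finset V} {l : E → ℝ}
    (hl : IsDimerLabeling ends l) {s s' s'' : Set E} (hs : IsCyclicSet ends s)
    (hu : s' ∪ s'' = s) (h1 : IsMatchingSet ends s') (h2 : IsMatchingSet ends s'')
    {v : V} (hv : v ∈ bdry ends s)
    (hsupp : {e : E | v ∈ ends e ∧ l e ≠ 0} = {e ∈ s | v ∈ ends e}) :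
    ∃ a ∈ s', ∃ b ∈ s'', {e ∈ s | v ∈ ends e} = {a, b} ∧ 0 < l a ∧ 0 < l b ∧
      l a + l b = 1 := by
  obtain ⟨a, b, hab, he⟩ := Set.ncard_eq_two.1 (hs.2 v hv)
  have ha : a ∈ {e ∈ s | v ∈ ends e} := by simp [he]
  have hb : b ∈ {e ∈ s | v ∈ ends e} := by simp [he]
  have ha' := hsupp ▸ ha
  have hb' := hsupp ▸ hb
  have hsum := (hl.2 v).2
  rw [hsupp, he, finsum_mem_pair hab] at hsum
  have hpa : 0 < l a := lt_of_le_of_ne (hl.1 a) ha'.2.symm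
  have hpb : 0 < l b := lt_of_le_of_ne (hl.1 b) hb'.2.symm
  have not_both {A : Set E} (hA : IsMatchingSet ends A) (haA : a ∈ A) (hbA : b ∈ A) : False :=
    Set.disjoint_left.1 (hA a haA b hbA hab) ha.2 hb.2
  have has : a ∈ s' ∪ s'' := hu ▸ ha.1
  have hbs : b ∈ s' ∪ s'' := hu ▸ hb.1
  rcases has with has | has <;> rcases hbs with hbs | hbs
  · exact (not_both h1 has hbs).elim
  · exact ⟨a, has, b, hbs, he, hpa, hpb, hsum⟩
  · exact ⟨b, hbs, a, has, by rw [he, Set.pair_comm], hpb, hpa, by rwa [add_comm]⟩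
  · exact (not_both h2 has hbs).elim

/-- From the proof of Theorem 10.2: if the edges with nonzero label incident to
each vertex of an even cycle `s` with halves `s'`, `s''` are exactly the two edges
of `s` at that vertex, then the labeling equals some `x ∈ (0,1)` on `s'` and
`1 - x` on `s''`. -/
theorem dimerLabeling_even_cycle_halves (ends : E → Finset V)
    (hcard : ∀ e, (ends e).card = 2) (l : E → ℝ) (hl : IsDimerLabeling ends l)
    (s s' s'' : Set E) (hs : IsEvenCycle ends s)
    (hu : s' ∪ s'' = s) (hd : Disjoint s' s'')
    (h1 : IsMatchingSet ends s') (h2 : IsMatchingSet ends s'')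
    (hsupp : ∀ v ∈ bdry ends s,
      {e : E | v ∈ ends e ∧ l e ≠ 0} = {e ∈ s | v ∈ ends e}) :
    ∃ x : ℝ, 0 < x ∧ x < 1 ∧ (∀ e ∈ s', l e = x) ∧ ∀ e ∈ s'', l e = 1 - x := by
  obtain ⟨⟨hcyc, hne, hmin⟩, -⟩ := hs
  have key (v : V) (hv : v ∈ bdry ends s) :=
    hl.exists_pair_of_mem_bdry hcyc hu h1 h2 hv (hsupp v hv)
  have mem_bdry {t : Set E} {v : V} : v ∈ bdry ends t ↔ ∃ e ∈ t, v ∈ ends e := by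
    simp [bdry]
  obtain ⟨e, he⟩ := hne
  obtain ⟨v, hv⟩ : (ends e).Nonempty := Finset.card_pos.1 (by rw [hcard]; norm_num)
  obtain ⟨a, ha, b, hb, -, hpa, hpb, hab⟩ := key v (mem_bdry.2 ⟨e, he, hv⟩)
  have hdis {c : E} (hc : c ∈ s') (hc' : c ∈ s'') : False := Set.disjoint_left.1 hd hc hc'
  let t : Set E := {c ∈ s | (c ∈ s' → l c = l a) ∧ (c ∈ s'' → l c = 1 - l a)}
  have hts : t ⊆ s := fun c hc => hc.1
  have htcyc : IsCyclicSet ends t := by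
    refine ⟨hcyc.1.subset hts, fun w hw => ?_⟩
    obtain ⟨c, hc, hwc⟩ := mem_bdry.1 hw
    have hws : w ∈ bdry ends s := mem_bdry.2 ⟨c, hts hc, hwc⟩
    rw [← hcyc.2 w hws]
    congr 1
    refine Set.Subset.antisymm (fun d hd => ⟨hts hd.1, hd.2⟩) fun d hd => ⟨⟨hd.1, ?_⟩, hd.2⟩
    obtain ⟨p, hp, q, hq, hpq, -, -, hsum⟩ := key w hws
    have hcpq : c ∈ ({p, q} : Set E) := hpq ▸ ⟨hts hc, hwc⟩
    have hdpq : d ∈ ({p, q} : Set E) := hpq ▸ hd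
    have hlp : l p = l a := by
      rcases hcpq with rfl | rfl
      · exact hc.2.1 hp
      · linarith [hc.2.2 hq]
    rcases hdpq with rfl | rfl
    · exact ⟨fun _ => hlp, fun h => (hdis hp h).elim⟩
    · exact ⟨fun h => (hdis h hq).elim, fun _ => by linarith⟩
  have hteq : t = s := hmin t hts htcyc
    ⟨a, hu ▸ Or.inl ha, fun _ => rfl, fun h => (hdis ha h).elim⟩
  have mem_t {c : E} (hc : c ∈ s' ∪ s'') : c ∈ t := by rwa [hteq, ← hu]
  exact ⟨l a, hpa, by linarith, fun c hc => (mem_t (Or.inl hc)).2.1 hc,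
    fun c hc => (mem_t (Or.inr hc)).2.2 hc⟩
end

section
/- Let A be a perfect matching in a hypergraph and let s, t be even cycles with ∂s ∩ ∂t = ∅ such that s Δ A and t Δ A are perfect matchings. Then s Δ (t Δ A) is a perfect matching. -/
open scoped symmDiff

variable {V E : Type*}

/-- A perfect matching in a hypergraph: a matching whose edges' boundaries cover
all vertices. -/
def HIsPerfectMatching (bd : E → Set V) (A : Set E) : Prop :=
  HIsMatching bd A ∧ ⋃ e ∈ A, bd e = Set.univ

/-- An even cycle in a hypergraph: a cycle admitting a partition into two halves,
each consisting of edges with pairwise disjoint boundaries. -/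
def HIsEvenCycle (bd : E → Set V) (s : Set E) : Prop :=
  HIsCycle bd s ∧ ∃ s₁ s₂ : Set E, s₁ ∪ s₂ = s ∧ Disjoint s₁ s₂ ∧
    HIsMatching bd s₁ ∧ HIsMatching bd s₂

theorem hIsPerfectMatching_iff_existsUnique {bd : E → Set V} {A : Set E} :
    HIsPerfectMatching bd A ↔ ∀ v : V, ∃! e, e ∈ A ∧ v ∈ bd e := by
  constructor
  · rintro ⟨hmatch, hcover⟩ v
    have hv : v ∈ ⋃ e ∈ A, bd e := hcover ▸ Set.mem_univ v
    simp only [Set.mem_iUnion, exists_prop] at hv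
    obtain ⟨e, heA, hve⟩ := hv
    refine ⟨e, ⟨heA, hve⟩, fun f ⟨hfA, hvf⟩ => ?_⟩
    by_contra hfe
    have hmem : v ∈ bd f ∩ bd e := ⟨hvf, hve⟩
    rwa [hmatch f hfA e heA hfe] at hmem
  · intro h
    refine ⟨fun e he f hf hef => ?_, Set.eq_univ_of_forall fun v => ?_⟩
    · refine Set.eq_empty_of_forall_notMem fun v hv => hef ?_
      exact (h v).unique ⟨he, hv.1⟩ ⟨hf, hv.2⟩
    · obtain ⟨e, ⟨heA, hve⟩, -⟩ := h v
      exact Set.mem_biUnion heA hve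

theorem mem_symmDiff_and_mem_iff_of_notMem_hbdry {bd : E → Set V} {s A : Set E} {v : V}
    (hv : v ∉ hbdry bd s) (e : E) : e ∈ s ∆ A ∧ v ∈ bd e ↔ e ∈ A ∧ v ∈ bd e := by
  have hes : v ∈ bd e → e ∉ s := fun hve hes => hv (Set.mem_biUnion hes hve)
  rw [Set.mem_symmDiff]
  tauto

/-- The square condition for perfect matchings in hypergraphs (Section 11.3): if
`A`, `s Δ A`, `t Δ A` are perfect matchings and `s, t` are independent even cycles,
then `s Δ (t Δ A)` is a perfect matching. -/
theorem hypergraph_perfectMatching_square_condition (bd : E → Set V)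
    (hne : ∀ e : E, (bd e).Nonempty) (hcov : ⋃ e : E, bd e = Set.univ)
    (A s t : Set E) (hA : HIsPerfectMatching bd A)
    (hs : HIsEvenCycle bd s) (ht : HIsEvenCycle bd t)
    (hind : hbdry bd s ∩ hbdry bd t = ∅)
    (hsA : HIsPerfectMatching bd (s ∆ A)) (htA : HIsPerfectMatching bd (t ∆ A)) :
    HIsPerfectMatching bd (s ∆ (t ∆ A)) := by
  rw [hIsPerfectMatching_iff_existsUnique] at hsA htA ⊢
  intro v
  by_cases hvs : v ∈ hbdry bd s
  · have hvt : v ∉ hbdry bd t := fun hvt => by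
      have hmem : v ∈ hbdry bd s ∩ hbdry bd t := ⟨hvs, hvt⟩
      rwa [hind] at hmem
    rw [symmDiff_left_comm]
    simpa only [mem_symmDiff_and_mem_iff_of_notMem_hbdry hvt] using hsA v
  · simpa only [mem_symmDiff_and_mem_iff_of_notMem_hbdry hvs] using htA v
end

section
/- Let s be a cycle in a hypergraph admitting a partition s = s′ ∪ s′′ into two halves, i.e., two sets such that any two distinct edges in the same set have disjoint boundaries. Then this partition is unique (up to exchanging s′ and s′′), and ⋃_{e∈s′} ∂e = ⋃_{e∈s′′} ∂e. -/
open scoped symmDiff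

variable {V E : Type*}

/-- Two distinct edges sharing a vertex cannot lie in the same matching. -/
theorem HIsMatching.eq_of_mem {bd : E → Set V} {A : Set E} (h : HIsMatching bd A) {e f : E}
    {v : V} (he : e ∈ A) (hf : f ∈ A) (hve : v ∈ bd e) (hvf : v ∈ bd f) : e = f := by
  by_contra hef
  have hv : v ∈ bd e ∩ bd f := ⟨hve, hvf⟩
  rwa [h e he f hf hef] at hv

/-- If a set of edges is partitioned into two matchings, then two distinct edges sharing a
vertex lie in different parts. -/
theorem HIsMatching.mem_iff_notMem {bd : E → Set V} {s A B : Set E} (hu : A ∪ B = s)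
    (hA : HIsMatching bd A) (hB : HIsMatching bd B) {e f : E} {v : V}
    (he : e ∈ s) (hf : f ∈ s) (hef : e ≠ f) (hve : v ∈ bd e) (hvf : v ∈ bd f) :
    e ∈ A ↔ f ∉ A := by
  subst hu
  refine ⟨fun h h' => hef (hA.eq_of_mem h h' hve hvf), fun h' => ?_⟩
  by_contra h
  exact hef (hB.eq_of_mem (he.resolve_left h) (hf.resolve_left h') hve hvf)

/-- In a cyclic set, an edge shares each of its vertices with another edge of the set. -/
theorem HIsCyclicSet.exists_ne {bd : E → Set V} {s : Set E} (hs : HIsCyclicSet bd s) {e : E}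
    {v : V} (he : e ∈ s) (hv : v ∈ bd e) : ∃ f ∈ s, f ≠ e ∧ v ∈ bd f := by
  have hmem : e ∈ {e ∈ s | v ∈ bd e} := ⟨he, hv⟩
  rcases hs.2 v with h | h
  · simp [h] at hmem
  · obtain ⟨f, hf, hfe⟩ := Set.exists_ne_of_one_lt_ncard (h.symm ▸ one_lt_two) e
    exact ⟨f, hf.1, hfe, hf.2⟩

/-- A subset of a cyclic set that is closed under adjacency is cyclic. -/
theorem HIsCyclicSet.of_closed {bd : E → Set V} {s r : Set E} (hs : HIsCyclicSet bd s)
    (hr : r ⊆ s) (hcl : ∀ e ∈ r, ∀ f ∈ s, ∀ v, v ∈ bd e → v ∈ bd f → f ∈ r) :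
    HIsCyclicSet bd r := by
  refine ⟨hs.1.subset hr, fun v => ?_⟩
  rcases Set.eq_empty_or_nonempty {e ∈ r | v ∈ bd e} with h | ⟨e, he, hve⟩
  · exact Or.inl h
  · have heq : {e ∈ r | v ∈ bd e} = {e ∈ s | v ∈ bd e} := by
      ext f
      exact ⟨fun hf => ⟨hr hf.1, hf.2⟩, fun hf => ⟨hcl e he f hf.1 v hve hf.2, hf.2⟩⟩
    rw [heq]
    exact hs.2 v

/-- If a cyclic set is the union of two matchings, every vertex covered by the first one is
covered by the second one. -/
theorem HIsCyclicSet.biUnion_subset {bd : E → Set V} {s A B : Set E} (hs : HIsCyclicSet bd s)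
    (hu : A ∪ B = s) (hA : HIsMatching bd A) : (⋃ e ∈ A, bd e) ⊆ ⋃ e ∈ B, bd e := by
  subst hu
  refine Set.iUnion₂_subset fun e he v hv => ?_
  obtain ⟨f, hf, hfe, hvf⟩ := hs.exists_ne (Or.inl he) hv
  exact Set.mem_biUnion (hf.resolve_left fun h => hfe (hA.eq_of_mem h he hvf hv)) hvf

/-- Section 11.2: if a cycle `s` in a hypergraph admits a partition into two
halves, then this partition is unique up to exchanging the halves, and the two
halves have the same union of boundaries. -/
theorem hypergraph_cycle_halves_unique (bd : E → Set V)
    (hne : ∀ e : E, (bd e).Nonempty) (hcov : ⋃ e : E, bd e = Set.univ)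
    (s s' s'' : Set E) (hs : HIsCycle bd s)
    (hu : s' ∪ s'' = s) (hd : Disjoint s' s'')
    (h1 : HIsMatching bd s') (h2 : HIsMatching bd s'') :
    (∀ t' t'' : Set E, t' ∪ t'' = s → Disjoint t' t'' →
        HIsMatching bd t' → HIsMatching bd t'' →
        (t' = s' ∧ t'' = s'') ∨ (t' = s'' ∧ t'' = s')) ∧
      (⋃ e ∈ s', bd e) = ⋃ e ∈ s'', bd e := by
  refine ⟨fun t' t'' htu htd k1 k2 => ?_,
    (hs.1.biUnion_subset hu h1).antisymm
      (hs.1.biUnion_subset ((Set.union_comm _ _).trans hu) h2)⟩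
  have hs'' : s'' = s \ s' := by rw [← hu, Set.union_sdiff_cancel_left hd.le_bot]
  have ht'' : t'' = s \ t' := by rw [← htu, Set.union_sdiff_cancel_left htd.le_bot]
  have hs's : s' ⊆ s := hu ▸ Set.subset_union_left
  have ht's : t' ⊆ s := htu ▸ Set.subset_union_left
  set r : Set E := {e ∈ s | e ∈ s' ↔ e ∈ t'}
  have hrs : r ⊆ s := fun e he => he.1
  have hcyc : HIsCyclicSet bd r := by
    refine hs.1.of_closed hrs fun e he f hf v hve hvf => ?_
    rcases eq_or_ne e f with rfl | hef
    · exact he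
    · have hse := HIsMatching.mem_iff_notMem hu h1 h2 he.1 hf hef hve hvf
      have hte := HIsMatching.mem_iff_notMem htu k1 k2 he.1 hf hef hve hvf
      exact ⟨hf, not_iff_not.mp (hse.symm.trans (he.2.trans hte))⟩
  rcases Set.eq_empty_or_nonempty r with hr0 | hrne
  · right
    have hne' : ∀ e ∈ s, ¬(e ∈ s' ↔ e ∈ t') := fun e he h =>
      Set.notMem_empty e (hr0 ▸ (⟨he, h⟩ : e ∈ r))
    subst hs'' ht''
    constructor <;> ext e <;> have := hne' e <;> have := @hs's e <;> have := @ht's e <;>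
      simp only [Set.mem_sdiff] <;> tauto
  · left
    have hrs_eq := hs.2.2 r hrs hcyc hrne
    have hst : t' = s' := by
      ext e
      exact ⟨fun h => (hrs_eq ▸ ht's h : e ∈ r).2.mpr h,
        fun h => (hrs_eq ▸ hs's h : e ∈ r).2.mp h⟩
    exact ⟨hst, by rw [hs'', ht'', hst]⟩
end
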